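/- Let K be a flag simplicial complex on [m], and let n_k(K) := dim_{Z/2} (N_K)_k. Then n_2(K) equals the number of 2-element subsets {i,j} ⊆ [m] that are not simplices of K, and n_3(K) = 2·t₀ + t₁, where t₀ is the number of 3-element subsets J ⊆ [m] containing no 2-element simplex of K, and t₁ is the number of 3-element subsets J ⊆ [m] containing exactly one 2-element simplex of K. -/

import Mathlib

/-- `K` is a simplicial complex on the vertex set `Fin m`. -/
def IsSimplicialComplex {m : ℕ} (K : Finset (Finset (Fin m))) : Prop :=
  (∀ I ∈ K, ∀ I' ⊆ I, I' ∈ K) ∧ ∅ ∈ K ∧ ∀ i : Fin m, ({i} : Finset (Fin m)) ∈ K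

/-- `K` is flag: every set of vertices pairwise joined by `2`-element simplices
of `K` is itself a simplex of `K`. -/
def IsFlag {m : ℕ} (K : Finset (Finset (Fin m))) : Prop :=
  ∀ S : Finset (Fin m),
    (∀ i ∈ S, ∀ j ∈ S, i ≠ j → ({i, j} : Finset (Fin m)) ∈ K) → S ∈ K

/-- `a` and `b` lie in the same connected component of the graph of the full
subcomplex `K_J`. -/
def connKJ {m : ℕ} (K : Finset (Finset (Fin m))) (J : Finset (Fin m)) :
    Fin m → Fin m → Prop :=
  Relation.ReflTransGen
    (fun a b => a ∈ J ∧ b ∈ J ∧ a ≠ b ∧ ({a, b} : Finset (Fin m)) ∈ K)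

/-- `Θ_K(J)`: the set of vertices `j ∈ J` that are smallest in their connected
component of the graph of `K_J`, this component not containing `max J`. -/
def Theta {m : ℕ} (K : Finset (Finset (Fin m))) (J : Finset (Fin m)) (j : Fin m) : Prop :=
  ∃ hj : j ∈ J, (∀ i ∈ J, connKJ K J j i → j ≤ i) ∧
    ¬ connKJ K J j (J.max' ⟨j, hj⟩)

/-- The Lie ideal of relations defining the graph Lie algebra `L_K` over `ℤ/2`. -/
noncomputable def LKrels {m : ℕ} (K : Finset (Finset (Fin m))) :
    LieIdeal (ZMod 2) (FreeLieAlgebra (ZMod 2) (Fin m)) :=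
  LieSubmodule.lieSpan (ZMod 2) (FreeLieAlgebra (ZMod 2) (Fin m))
    {z | ∃ i j : Fin m, ({i, j} : Finset (Fin m)) ∈ K ∧
      z = ⁅FreeLieAlgebra.of (ZMod 2) i, FreeLieAlgebra.of (ZMod 2) j⁆}

/-- The graph Lie algebra `L_K` over `ℤ/2`. -/
abbrev LK {m : ℕ} (K : Finset (Finset (Fin m))) :=
  FreeLieAlgebra (ZMod 2) (Fin m) ⧸ LKrels K

/-- The generators `μ₁, …, μ_m` of `L_K`. -/
noncomputable def mu {m : ℕ} (K : Finset (Finset (Fin m))) (i : Fin m) : LK K :=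
  LieSubmodule.Quotient.mk (N := LKrels K) (FreeLieAlgebra.of (ZMod 2) i)

/-- For `q : Fin m → L` and `I = {t₁ < … < t_s} ⊆ [m]`, the nested commutator
`c_q(I, x) = ⁅q t₁, ⁅q t₂, … ⁅q t_s, x⁆…⁆⁆`, with `c_q(∅, x) = x`. -/
def cNest {L : Type*} [LieRing L] {m : ℕ} (q : Fin m → L) (I : Finset (Fin m)) (x : L) : L :=
  (I.sort (· ≤ ·)).foldr (fun t acc => ⁅q t, acc⁆) x

/-- The set of GPTW generators of `L_K`. -/
def GPTWset {m : ℕ} (K : Finset (Finset (Fin m))) : Set (LK K) :=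
  {z | ∃ (J : Finset (Fin m)) (j : Fin m),
    Theta K J j ∧ z = cNest (mu K) (J.erase j) (mu K j)}

/-- `N_K`, the Lie subalgebra of `L_K` generated by the GPTW generators. -/
noncomputable def NK {m : ℕ} (K : Finset (Finset (Fin m))) : LieSubalgebra (ZMod 2) (LK K) :=
  LieSubalgebra.lieSpan (ZMod 2) (LK K) (GPTWset K)

/-- `IsBracketing k x` : `x` is an iterated bracket of `k` generators of the
free Lie algebra (a homogeneous monomial of bracket length `k`). -/
inductive IsBracketing {m : ℕ} : ℕ → FreeLieAlgebra (ZMod 2) (Fin m) → Prop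
  | of (i : Fin m) : IsBracketing 1 (FreeLieAlgebra.of (ZMod 2) i)
  | lie {k l : ℕ} {x y : FreeLieAlgebra (ZMod 2) (Fin m)} :
      IsBracketing k x → IsBracketing l y → IsBracketing (k + l) ⁅x, y⁆

/-- The degree-`k` component of the free Lie algebra, graded by bracket
length. -/
noncomputable def FLdeg (m : ℕ) (k : ℕ) :
    Submodule (ZMod 2) (FreeLieAlgebra (ZMod 2) (Fin m)) :=
  Submodule.span (ZMod 2) {x | IsBracketing k x}

/-- The degree-`k` component of `L_K`. -/
noncomputable def LKdeg {m : ℕ} (K : Finset (Finset (Fin m))) (k : ℕ) :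
    Submodule (ZMod 2) (LK K) :=
  (FLdeg m k).map (LieSubmodule.Quotient.mk' (LKrels K)).toLinearMap

/-- The degree-`k` component `(N_K)_k = N_K ∩ (L_K)_k`. -/
noncomputable def NKdeg {m : ℕ} (K : Finset (Finset (Fin m))) (k : ℕ) :
    Submodule (ZMod 2) (LK K) :=
  (NK K).toSubmodule ⊓ LKdeg K k

/-- `n_k(K) = dim_{ℤ/2} (N_K)_k`. -/
noncomputable def nDim {m : ℕ} (K : Finset (Finset (Fin m))) (k : ℕ) : ℕ :=
  Module.finrank (ZMod 2) (NKdeg K k)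

section GradedStructure

attribute [local instance] LieRing.ofAssociativeRing LieAlgebra.ofAssociativeAlgebra

variable {m : ℕ} {K : Finset (Finset (Fin m))}

open scoped TensorProduct

/-- The universal property of `L_K`. -/
noncomputable def LKlift {L : Type*} [LieRing L] [LieAlgebra (ZMod 2) L] (q : Fin m → L)
    (hq : ∀ i j : Fin m, ({i, j} : Finset (Fin m)) ∈ K → ⁅q i, q j⁆ = 0) :
    LK K →ₗ⁅ZMod 2⁆ L :=
  have hle : LKrels K ≤ (FreeLieAlgebra.lift (ZMod 2) q).ker := by
    refine LieSubmodule.lieSpan_le.2 ?_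
    rintro _ ⟨i, j, hij, rfl⟩
    simp [LieHom.mem_ker, hq i j hij]
  { Submodule.liftQ (LKrels K).toSubmodule (FreeLieAlgebra.lift (ZMod 2) q).toLinearMap hle with
    map_lie' := by
      intro x y
      obtain ⟨x, rfl⟩ := LieSubmodule.Quotient.surjective_mk' _ x
      obtain ⟨y, rfl⟩ := LieSubmodule.Quotient.surjective_mk' _ y
      exact (FreeLieAlgebra.lift (ZMod 2) q).map_lie x y }

theorem LKlift_mk {L : Type*} [LieRing L] [LieAlgebra (ZMod 2) L] (q : Fin m → L)
    (hq : ∀ i j : Fin m, ({i, j} : Finset (Fin m)) ∈ K → ⁅q i, q j⁆ = 0)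
    (x : FreeLieAlgebra (ZMod 2) (Fin m)) :
    LKlift q hq (LieSubmodule.Quotient.mk (N := LKrels K) x) =
      FreeLieAlgebra.lift (ZMod 2) q x := rfl

theorem LKlift_mu {L : Type*} [LieRing L] [LieAlgebra (ZMod 2) L] (q : Fin m → L)
    (hq : ∀ i j : Fin m, ({i, j} : Finset (Fin m)) ∈ K → ⁅q i, q j⁆ = 0) (i : Fin m) :
    LKlift q hq (mu K i) = q i := by
  rw [mu, LKlift_mk, FreeLieAlgebra.lift_of_apply]

theorem lie_mu_eq_zero {i j : Fin m} (h : ({i, j} : Finset (Fin m)) ∈ K) :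
    ⁅mu K i, mu K j⁆ = 0 := by
  rw [mu, mu, ← LieSubmodule.Quotient.mk_bracket, LieSubmodule.Quotient.mk_eq_zero']
  exact LieSubmodule.subset_lieSpan ⟨i, j, h, rfl⟩

/-- The Lie homomorphism multiplying elements of degree `k` by the `k`-th power of a formal
variable. -/
noncomputable def LKgrading (K : Finset (Finset (Fin m))) :
    LK K →ₗ⁅ZMod 2⁆ (Polynomial (ZMod 2) ⊗[ZMod 2] LK K) :=
  LKlift (fun i => Polynomial.X ⊗ₜ mu K i) fun i j h => by
    rw [LieAlgebra.ExtendScalars.bracket_tmul, lie_mu_eq_zero h, TensorProduct.tmul_zero]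

/-- The projection of `L_K` to its component of degree `k`. -/
noncomputable def LKproj (K : Finset (Finset (Fin m))) (k : ℕ) : LK K →ₗ[ZMod 2] LK K :=
  (TensorProduct.lid (ZMod 2) (LK K)).toLinearMap ∘ₗ
    (Polynomial.lcoeff (ZMod 2) k).rTensor (LK K) ∘ₗ (LKgrading K).toLinearMap

theorem IsBracketing.grading {k : ℕ} {x : FreeLieAlgebra (ZMod 2) (Fin m)}
    (hx : IsBracketing k x) :
    LKgrading K (LieSubmodule.Quotient.mk (N := LKrels K) x) =
      (Polynomial.X ^ k) ⊗ₜ LieSubmodule.Quotient.mk (N := LKrels K) x := by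
  induction hx with
  | of i => rw [pow_one]; exact LKlift_mu _ _ i
  | lie _ _ ihx ihy =>
    rw [LieSubmodule.Quotient.mk_bracket, LieHom.map_lie, ihx, ihy,
      LieAlgebra.ExtendScalars.bracket_tmul, pow_add]

theorem LKproj_of_mem {k l : ℕ} {x : LK K} (hx : x ∈ LKdeg K l) :
    LKproj K k x = if l = k then x else 0 := by
  obtain ⟨x, hx, rfl⟩ := hx
  induction hx using Submodule.span_induction with
  | mem x hx =>
    have := IsBracketing.grading (K := K) hx
    change (TensorProduct.lid (ZMod 2) (LK K)) ((Polynomial.lcoeff (ZMod 2) k).rTensor (LK K)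
      (LKgrading K (LieSubmodule.Quotient.mk (N := LKrels K) x))) =
      if l = k then (LieSubmodule.Quotient.mk (N := LKrels K) x) else 0
    rw [this]
    simp [Polynomial.coeff_X_pow, eq_comm]
  | zero => simp
  | add x y _ _ hx hy => rw [map_add, map_add, hx, hy]; split_ifs <;> simp
  | smul a x _ hx => rw [map_smul, map_smul, hx]; split_ifs <;> simp

theorem mu_mem_LKdeg (i : Fin m) : mu K i ∈ LKdeg K 1 :=
  ⟨_, Submodule.subset_span (IsBracketing.of i), rfl⟩

theorem lie_mem_LKdeg {k l : ℕ} {x y : LK K} (hx : x ∈ LKdeg K k) (hy : y ∈ LKdeg K l) :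
    ⁅x, y⁆ ∈ LKdeg K (k + l) := by
  obtain ⟨x, hx, rfl⟩ := hx
  obtain ⟨y, hy, rfl⟩ := hy
  refine ⟨⁅x, y⁆, ?_, rfl⟩
  induction hx, hy using Submodule.span_induction₂ with
  | mem_mem x y hx hy => exact Submodule.subset_span (hx.lie hy)
  | zero_left => simp
  | zero_right => simp
  | add_left _ _ _ _ _ _ hx hy => rw [add_lie]; exact add_mem hx hy
  | add_right _ _ _ _ _ _ hx hy => rw [lie_add]; exact add_mem hx hy
  | smul_left a _ _ _ _ h => rw [smul_lie]; exact Submodule.smul_mem _ _ h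
  | smul_right a _ _ _ _ h => rw [lie_smul]; exact Submodule.smul_mem _ _ h

theorem foldr_lie_mem_LKdeg (l : List (Fin m)) (j : Fin m) :
    l.foldr (fun t acc => ⁅mu K t, acc⁆) (mu K j) ∈ LKdeg K (l.length + 1) := by
  induction l with
  | nil => exact mu_mem_LKdeg j
  | cons a l ih =>
    rw [List.foldr_cons, List.length_cons, add_comm _ 1]
    exact lie_mem_LKdeg (mu_mem_LKdeg a) ih

theorem cNest_erase_mem_LKdeg {J : Finset (Fin m)} {j : Fin m} (hj : j ∈ J) :
    cNest (mu K) (J.erase j) (mu K j) ∈ LKdeg K J.card := by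
  have := foldr_lie_mem_LKdeg (K := K) ((J.erase j).sort (· ≤ ·)) j
  rwa [Finset.length_sort, Finset.card_erase_add_one hj] at this

/-- The sum of the components of `L_K` of degree at least `d`. -/
noncomputable def LKge (K : Finset (Finset (Fin m))) (d : ℕ) : Submodule (ZMod 2) (LK K) :=
  ⨆ k ≥ d, LKdeg K k

theorem LKdeg_le_LKge {d k : ℕ} (h : d ≤ k) : LKdeg K k ≤ LKge K d :=
  le_iSup₂_of_le k h le_rfl

theorem LKge_antitone {d e : ℕ} (h : d ≤ e) : LKge K e ≤ LKge K d :=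
  iSup₂_le fun _ hk => LKdeg_le_LKge (h.trans hk)

theorem LKproj_eq_zero_of_mem_LKge {d k : ℕ} (h : k < d) {x : LK K} (hx : x ∈ LKge K d) :
    LKproj K k x = 0 := by
  have : LKge K d ≤ LinearMap.ker (LKproj K k) := by
    refine iSup₂_le fun l hl x hx => ?_
    rw [LinearMap.mem_ker, LKproj_of_mem hx, if_neg (by lia)]
  exact this hx

theorem lie_mem_LKge {d e : ℕ} {x y : LK K} (hx : x ∈ LKge K d) (hy : y ∈ LKge K e) :
    ⁅x, y⁆ ∈ LKge K (d + e) := by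
  have hx' : LKge K d ≤ (LKge K (d + e)).comap
      ((LieModule.toEnd (ZMod 2) (LK K) (LK K)).toLinearMap.flip y) := by
    refine iSup₂_le fun k hk x hx => ?_
    have hy' : LKge K e ≤ (LKge K (d + e)).comap (LieModule.toEnd (ZMod 2) (LK K) (LK K) x) := by
      refine iSup₂_le fun l hl y hy => ?_
      exact LKdeg_le_LKge (add_le_add hk hl) (lie_mem_LKdeg hx hy)
    exact hy' hy
  exact hx' hx

end GradedStructure

section Generators

variable {m : ℕ} {K : Finset (Finset (Fin m))}

/-- The pairs `(j, c)` indexing the GPTW generators of degree `2`. -/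
def pairIndex (K : Finset (Finset (Fin m))) : Finset (Fin m × Fin m) :=
  Finset.univ.filter fun p => p.1 < p.2 ∧ {p.1, p.2} ∉ K

/-- The triples `(s, j, c)` indexing the GPTW generators of degree `3`. -/
def tripleIndex (K : Finset (Finset (Fin m))) : Finset (Fin m × Fin m × Fin m) :=
  Finset.univ.filter fun p => p.1 ≠ p.2.1 ∧ p.1 < p.2.2 ∧ p.2.1 < p.2.2 ∧ {p.2.1, p.2.2} ∉ K ∧
    ({p.1, p.2.1} ∉ K ∨ (p.2.1 < p.1 ∧ {p.1, p.2.2} ∉ K))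

/-- The GPTW generators of degree `2`. -/
noncomputable def pairGen (K : Finset (Finset (Fin m))) (p : pairIndex K) : LK K :=
  ⁅mu K p.1.2, mu K p.1.1⁆

/-- The GPTW generators of degree `3`. -/
noncomputable def tripleGen (K : Finset (Finset (Fin m))) (p : tripleIndex K) : LK K :=
  ⁅mu K p.1.1, ⁅mu K p.1.2.2, mu K p.1.2.1⁆⁆

theorem cNest_pair (K : Finset (Finset (Fin m))) {j c : Fin m} (h : j < c) :
    cNest (mu K) (({j, c} : Finset (Fin m)).erase j) (mu K j) = ⁅mu K c, mu K j⁆ := by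
  rw [Finset.erase_insert (by simpa using h.ne)]
  simp [cNest]

theorem cNest_triple (K : Finset (Finset (Fin m))) {s j c : Fin m} (hsj : s ≠ j) (hsc : s < c)
    (hjc : j < c) :
    cNest (mu K) (({j, s, c} : Finset (Fin m)).erase j) (mu K j) =
      ⁅mu K s, ⁅mu K c, mu K j⁆⁆ := by
  rw [Finset.erase_insert (by simp [hsj.symm, hjc.ne]), cNest,
    Finset.sort_insert (s := {c}) _ (by simpa using hsc.le) (by simpa using hsc.ne)]
  simp

theorem theta_pair {j c : Fin m} (h : j < c) (hK : {j, c} ∉ K) : Theta K {j, c} j := by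
  have key : ∀ i, connKJ K {j, c} j i → i = j := by
    intro i hi
    induction hi with
    | refl => rfl
    | tail _ h ih => grind
  refine ⟨by simp, fun i _ hi => (key i hi).ge, fun hc => ?_⟩
  exact absurd ((Finset.le_max' _ c (by simp)).trans (key _ hc).le) h.not_ge

theorem theta_triple {s j c : Fin m} (hsc : s < c) (hjc : j < c) (hK : {j, c} ∉ K)
    (hK' : {s, j} ∉ K ∨ (j < s ∧ {s, c} ∉ K)) : Theta K {j, s, c} j := by
  have key : ∀ i, connKJ K {j, s, c} j i → i = j ∨ (i = s ∧ {s, j} ∈ K) := by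
    intro i hi
    induction hi with
    | refl => simp
    | tail _ h ih =>
      have := Finset.pair_comm s j
      grind
  refine ⟨by simp, fun i _ hi => ?_, fun hc => ?_⟩
  · grind
  · have := Finset.le_max' ({j, s, c} : Finset (Fin m)) c (by simp)
    grind

theorem Theta.exists_max {J : Finset (Fin m)} {j : Fin m} (h : Theta K J j) :
    ∃ c ∈ J, (∀ i ∈ J, i ≤ c) ∧ j < c ∧ (∀ i ∈ J, connKJ K J j i → j ≤ i) ∧
      ¬ connKJ K J j c := by
  obtain ⟨hj, hmin, hmax⟩ := h
  refine ⟨_, J.max'_mem _, fun i hi => J.le_max' i hi,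
    lt_of_le_of_ne (J.le_max' j hj) fun h => hmax ?_, hmin, hmax⟩
  rw [← h]
  exact Relation.ReflTransGen.refl

theorem Theta.two_le_card {J : Finset (Fin m)} {j : Fin m} (h : Theta K J j) : 2 ≤ J.card := by
  obtain ⟨c, hc, -, hjc, -⟩ := h.exists_max
  exact Finset.one_lt_card.2 ⟨j, h.choose, c, hc, hjc.ne⟩

theorem connKJ_of_edge {J : Finset (Fin m)} {a b : Fin m} (ha : a ∈ J) (hb : b ∈ J)
    (hne : a ≠ b) (hK : {a, b} ∈ K) : connKJ K J a b :=
  Relation.ReflTransGen.single ⟨ha, hb, hne, hK⟩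

theorem cNest_mem_range_pairGen {J : Finset (Fin m)} {j : Fin m} (h : Theta K J j)
    (hJ : J.card = 2) : cNest (mu K) (J.erase j) (mu K j) ∈ Set.range (pairGen K) := by
  obtain ⟨c, hc, -, hjc, -, hconn⟩ := h.exists_max
  have hj : j ∈ J := h.choose
  obtain rfl : {j, c} = J := Finset.eq_of_subset_of_card_le (by grind)
    (by rw [hJ, Finset.card_pair hjc.ne])
  have hK : {j, c} ∉ K := fun hK => hconn (connKJ_of_edge hj hc hjc.ne hK)
  exact ⟨⟨(j, c), by simp [pairIndex, hjc, hK]⟩, (cNest_pair K hjc).symm⟩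

theorem cNest_mem_range_tripleGen {J : Finset (Fin m)} {j : Fin m} (h : Theta K J j)
    (hJ : J.card = 3) : cNest (mu K) (J.erase j) (mu K j) ∈ Set.range (tripleGen K) := by
  obtain ⟨c, hc, hmax, hjc, hmin, hconn⟩ := h.exists_max
  have hj : j ∈ J := h.choose
  obtain ⟨s, hs⟩ : ((J.erase j).erase c).Nonempty := by
    rw [← Finset.card_pos, Finset.card_erase_of_mem (by simp [hc, hjc.ne']),
      Finset.card_erase_of_mem hj, hJ]
    simp
  simp only [Finset.mem_erase] at hs
  obtain ⟨hsc, hsj, hs⟩ := hs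
  obtain rfl : {j, s, c} = J := Finset.eq_of_subset_of_card_le (by grind)
    (by rw [hJ, Finset.card_eq_three.2 ⟨j, s, c, hsj.symm, hjc.ne, hsc, rfl⟩])
  have hsc' : s < c := lt_of_le_of_ne (hmax s hs) hsc
  have hK : {j, c} ∉ K := fun hK => hconn (connKJ_of_edge hj hc hjc.ne hK)
  have hK' : {s, j} ∉ K ∨ (j < s ∧ {s, c} ∉ K) := by
    by_contra! hcon
    rw [Finset.pair_comm s j] at hcon
    have h1 := connKJ_of_edge hj hs hsj.symm hcon.1
    exact hconn (h1.trans (connKJ_of_edge hs hc hsc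
      (hcon.2 (lt_of_le_of_ne (hmin s hs h1) hsj.symm))))
  exact ⟨⟨(s, j, c), by simp only [tripleIndex, Finset.mem_filter_univ]; tauto⟩,
    (cNest_triple K hsj hsc' hjc).symm⟩

theorem pairGen_mem_NK (p : pairIndex K) : pairGen K p ∈ NK K := by
  obtain ⟨⟨j, c⟩, hp⟩ := p
  have hp' := hp
  simp only [pairIndex, Finset.mem_filter_univ] at hp'
  rw [pairGen, ← cNest_pair K hp'.1]
  exact LieSubalgebra.subset_lieSpan ⟨_, j, theta_pair hp'.1 hp'.2, rfl⟩

theorem tripleGen_mem_NK (p : tripleIndex K) : tripleGen K p ∈ NK K := by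
  obtain ⟨⟨s, j, c⟩, hp⟩ := p
  have hp' := hp
  simp only [tripleIndex, Finset.mem_filter_univ] at hp'
  obtain ⟨hsj, hsc, hjc, hK, hK'⟩ := hp'
  rw [tripleGen, ← cNest_triple K hsj hsc hjc]
  exact LieSubalgebra.subset_lieSpan ⟨_, j, theta_triple hsc hjc hK hK', rfl⟩

theorem pairGen_mem_LKdeg (p : pairIndex K) : pairGen K p ∈ LKdeg K 2 := by
  rw [pairGen]
  exact lie_mem_LKdeg (k := 1) (l := 1) (mu_mem_LKdeg _) (mu_mem_LKdeg _)

theorem tripleGen_mem_LKdeg (p : tripleIndex K) : tripleGen K p ∈ LKdeg K 3 := by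
  rw [tripleGen]
  exact lie_mem_LKdeg (k := 1) (l := 2) (mu_mem_LKdeg _)
    (lie_mem_LKdeg (k := 1) (l := 1) (mu_mem_LKdeg _) (mu_mem_LKdeg _))

theorem pairGen_mem (p : pairIndex K) : pairGen K p ∈ NKdeg K 2 :=
  Submodule.mem_inf.2 ⟨pairGen_mem_NK p, pairGen_mem_LKdeg p⟩

theorem tripleGen_mem (p : tripleIndex K) : tripleGen K p ∈ NKdeg K 3 :=
  Submodule.mem_inf.2 ⟨tripleGen_mem_NK p, tripleGen_mem_LKdeg p⟩

theorem span_pairGen_le : Submodule.span (ZMod 2) (Set.range (pairGen K)) ≤ NKdeg K 2 :=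
  Submodule.span_le.2 (Set.range_subset_iff.2 pairGen_mem)

theorem span_tripleGen_le : Submodule.span (ZMod 2) (Set.range (tripleGen K)) ≤ NKdeg K 3 :=
  Submodule.span_le.2 (Set.range_subset_iff.2 tripleGen_mem)

theorem NK_le_of_LKge_le {P : Submodule (ZMod 2) (LK K)} (hP2 : P ≤ LKge K 2)
    (hP4 : LKge K 4 ≤ P) (hP : ∀ z ∈ GPTWset K, z ∈ P) : (NK K).toSubmodule ≤ P := by
  intro x hx
  change x ∈ LieSubalgebra.lieSpan (ZMod 2) (LK K) (GPTWset K) at hx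
  induction hx using LieSubalgebra.lieSpan_induction with
  | mem x hx => exact hP x hx
  | zero => exact P.zero_mem
  | add _ _ _ _ hx hy => exact P.add_mem hx hy
  | smul a _ _ hx => exact P.smul_mem a hx
  | lie _ _ _ _ hx hy =>
    have h := lie_mem_LKge (hP2 hx) (hP2 hy)
    exact hP4 h

theorem NK_le : (NK K).toSubmodule ≤ Submodule.span (ZMod 2) (Set.range (pairGen K)) ⊔
    (Submodule.span (ZMod 2) (Set.range (tripleGen K)) ⊔ LKge K 4) := by
  have h2 : Submodule.span (ZMod 2) (Set.range (pairGen K)) ≤ LKge K 2 :=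
    Submodule.span_le.2 (Set.range_subset_iff.2 fun p =>
      LKdeg_le_LKge le_rfl (pairGen_mem_LKdeg p))
  have h3 : Submodule.span (ZMod 2) (Set.range (tripleGen K)) ≤ LKge K 2 :=
    Submodule.span_le.2 (Set.range_subset_iff.2 fun p =>
      LKdeg_le_LKge (Nat.le_succ 2) (tripleGen_mem_LKdeg p))
  refine NK_le_of_LKge_le (sup_le h2 (sup_le h3 (LKge_antitone (by lia))))
    (le_sup_right.trans le_sup_right) ?_
  rintro z ⟨J, j, h, hz⟩
  obtain hJ | hJ | hJ : J.card = 2 ∨ J.card = 3 ∨ 4 ≤ J.card := by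
    have := h.two_le_card
    lia
  · have hmem := cNest_mem_range_pairGen h hJ
    rw [← hz] at hmem
    exact Submodule.mem_sup_left (Submodule.subset_span hmem)
  · have hmem := cNest_mem_range_tripleGen h hJ
    rw [← hz] at hmem
    exact Submodule.mem_sup_right (Submodule.mem_sup_left (Submodule.subset_span hmem))
  · have hmem := cNest_erase_mem_LKdeg (K := K) h.choose
    rw [← hz] at hmem
    exact Submodule.mem_sup_right (Submodule.mem_sup_right (LKdeg_le_LKge hJ hmem))

theorem NK_decomposition {x : LK K} (hx : x ∈ NK K) :
    LKproj K 2 x ∈ Submodule.span (ZMod 2) (Set.range (pairGen K)) ∧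
      LKproj K 3 x ∈ Submodule.span (ZMod 2) (Set.range (tripleGen K)) := by
  obtain ⟨a, ha, y, hy, rfl⟩ := Submodule.mem_sup.1 (NK_le hx)
  obtain ⟨b, hb, c, hc, rfl⟩ := Submodule.mem_sup.1 hy
  have ha' := (span_pairGen_le ha).2
  have hb' := (span_tripleGen_le hb).2
  simp [LKproj_of_mem ha', LKproj_of_mem hb', ha, hb,
    LKproj_eq_zero_of_mem_LKge (show 2 < 4 by lia) hc,
    LKproj_eq_zero_of_mem_LKge (show 3 < 4 by lia) hc]

theorem NKdeg_two : NKdeg K 2 = Submodule.span (ZMod 2) (Set.range (pairGen K)) := by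
  refine le_antisymm (fun x hx => ?_) span_pairGen_le
  simpa [LKproj_of_mem hx.2] using (NK_decomposition hx.1).1

theorem NKdeg_three : NKdeg K 3 = Submodule.span (ZMod 2) (Set.range (tripleGen K)) := by
  refine le_antisymm (fun x hx => ?_) span_tripleGen_le
  simpa [LKproj_of_mem hx.2] using (NK_decomposition hx.1).2

end Generators

section Independence

attribute [local instance] LieRing.ofAssociativeRing LieAlgebra.ofAssociativeAlgebra

variable {m : ℕ} {K : Finset (Finset (Fin m))}

/-- The strictly upper triangular matrices representing a generator when reading off the
coefficient of the word `x y`. -/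
def pairMatrix (x y i : Fin m) : Matrix (Fin 3) (Fin 3) (ZMod 2) :=
  !![0, if i = x then 1 else 0, 0; 0, 0, if i = y then 1 else 0; 0, 0, 0]

/-- The strictly upper triangular matrices representing a generator when reading off the
coefficient of the word `x y z`. -/
def wordMatrix (x y z i : Fin m) : Matrix (Fin 4) (Fin 4) (ZMod 2) :=
  !![0, if i = x then 1 else 0, 0, 0; 0, 0, if i = y then 1 else 0, 0;
    0, 0, 0, if i = z then 1 else 0; 0, 0, 0, 0]

theorem pairMatrix_mul (x y i j : Fin m) :
    pairMatrix x y i * pairMatrix x y j =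
      !![0, 0, if i = x ∧ j = y then 1 else 0; 0, 0, 0; 0, 0, 0] := by
  ext a b
  fin_cases a <;> fin_cases b <;>
    simp [pairMatrix, Matrix.mul_apply, Fin.sum_univ_succ, ← ite_and, and_comm]

theorem wordMatrix_mul (x y z i j : Fin m) :
    wordMatrix x y z i * wordMatrix x y z j =
      !![0, 0, if i = x ∧ j = y then 1 else 0, 0; 0, 0, 0, if i = y ∧ j = z then 1 else 0;
        0, 0, 0, 0; 0, 0, 0, 0] := by
  ext a b
  fin_cases a <;> fin_cases b <;>
    simp [wordMatrix, Matrix.mul_apply, Fin.sum_univ_succ, ← ite_and, and_comm]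

theorem not_edge_match {x y i j : Fin m} (hxy : ({x, y} : Finset (Fin m)) ∉ K)
    (h : ({i, j} : Finset (Fin m)) ∈ K) : ¬ (i = x ∧ j = y) := by
  rintro ⟨rfl, rfl⟩
  exact hxy h

theorem lie_pairMatrix {x y i j : Fin m} (hxy : ({x, y} : Finset (Fin m)) ∉ K)
    (h : ({i, j} : Finset (Fin m)) ∈ K) : ⁅pairMatrix x y i, pairMatrix x y j⁆ = 0 := by
  have h' : ({j, i} : Finset (Fin m)) ∈ K := Finset.pair_comm i j ▸ h
  rw [Ring.lie_def, pairMatrix_mul, pairMatrix_mul, if_neg (not_edge_match hxy h),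
    if_neg (not_edge_match hxy h'), sub_self]

theorem lie_wordMatrix {x y z i j : Fin m} (hxy : ({x, y} : Finset (Fin m)) ∉ K)
    (hyz : ({y, z} : Finset (Fin m)) ∉ K) (h : ({i, j} : Finset (Fin m)) ∈ K) :
    ⁅wordMatrix x y z i, wordMatrix x y z j⁆ = 0 := by
  have h' : ({j, i} : Finset (Fin m)) ∈ K := Finset.pair_comm i j ▸ h
  rw [Ring.lie_def, wordMatrix_mul, wordMatrix_mul, if_neg (not_edge_match hxy h),
    if_neg (not_edge_match hxy h'), if_neg (not_edge_match hyz h),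
    if_neg (not_edge_match hyz h'), sub_self]

/-- The coefficient of the word `x y` as a functional on `L_K`. -/
noncomputable def pairCoeff {x y : Fin m} (hxy : ({x, y} : Finset (Fin m)) ∉ K) : Module.Dual (ZMod 2) (LK K) :=
  Matrix.entryLinearMap (ZMod 2) (ZMod 2) 0 2 ∘ₗ
    (LKlift (K := K) (pairMatrix x y) fun _ _ => lie_pairMatrix hxy).toLinearMap

/-- The coefficient of the word `x y z` as a functional on `L_K`. -/
noncomputable def wordCoeff {x y z : Fin m} (hxy : ({x, y} : Finset (Fin m)) ∉ K) (hyz : ({y, z} : Finset (Fin m)) ∉ K) :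
    Module.Dual (ZMod 2) (LK K) :=
  Matrix.entryLinearMap (ZMod 2) (ZMod 2) 0 3 ∘ₗ
    (LKlift (K := K) (wordMatrix x y z) fun _ _ => lie_wordMatrix hxy hyz).toLinearMap

theorem pairCoeff_lie {x y : Fin m} (hxy : ({x, y} : Finset (Fin m)) ∉ K) (a b : Fin m) :
    pairCoeff hxy ⁅mu K a, mu K b⁆ =
      (if a = x ∧ b = y then 1 else 0) - (if b = x ∧ a = y then 1 else 0) := by
  change (LKlift (K := K) (pairMatrix x y) (fun _ _ => lie_pairMatrix hxy) ⁅mu K a, mu K b⁆) 0 2 = _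
  rw [LieHom.map_lie, LKlift_mu, LKlift_mu, Ring.lie_def, pairMatrix_mul, pairMatrix_mul]
  simp

theorem wordCoeff_lie {x y z : Fin m} (hxy : ({x, y} : Finset (Fin m)) ∉ K) (hyz : ({y, z} : Finset (Fin m)) ∉ K) (a b d : Fin m) :
    wordCoeff hxy hyz ⁅mu K a, ⁅mu K b, mu K d⁆⁆ =
      (if a = x ∧ b = y ∧ d = z then 1 else 0) - (if a = x ∧ d = y ∧ b = z then 1 else 0) -
      ((if b = x ∧ d = y ∧ a = z then 1 else 0) - (if d = x ∧ b = y ∧ a = z then 1 else 0)) := by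
  change (LKlift (K := K) (wordMatrix x y z) (fun _ _ => lie_wordMatrix hxy hyz)
    ⁅mu K a, ⁅mu K b, mu K d⁆⁆) 0 3 = _
  rw [LieHom.map_lie, LieHom.map_lie, LKlift_mu, LKlift_mu, LKlift_mu, Ring.lie_def, Ring.lie_def,
    wordMatrix_mul, wordMatrix_mul]
  simp [wordMatrix, ite_and]
  split_ifs <;> simp_all

theorem linearIndependent_pairGen : LinearIndependent (ZMod 2) (pairGen K) := by
  have hmem (p : pairIndex K) : p.1.1 < p.1.2 ∧ {p.1.1, p.1.2} ∉ K := by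
    simpa [pairIndex] using p.2
  refine LinearIndependent.of_pairwise_dual_eq_zero_one _
    (fun p => pairCoeff (hmem p).2) (fun p q hpq => ?_) (fun p => ?_)
  · have hp := (hmem p).1
    have hq := (hmem q).1
    have hne : ¬ (p.1.1 = q.1.1 ∧ p.1.2 = q.1.2) := fun h =>
      hpq (Subtype.ext (Prod.ext h.1 h.2))
    change pairCoeff (hmem p).2 (pairGen K q) = 0
    rw [pairGen, pairCoeff_lie, if_neg (by grind), if_neg (by grind), sub_zero]
  · have hp := (hmem p).1
    rw [pairGen, pairCoeff_lie, if_neg (by grind), if_pos ⟨rfl, rfl⟩]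
    decide

theorem linearIndependent_tripleGen : LinearIndependent (ZMod 2) (tripleGen K) := by
  have hmem (p : tripleIndex K) : p.1.1 ≠ p.1.2.1 ∧ p.1.1 < p.1.2.2 ∧ p.1.2.1 < p.1.2.2 ∧
      {p.1.2.1, p.1.2.2} ∉ K ∧
      ({p.1.1, p.1.2.1} ∉ K ∨ (p.1.2.1 < p.1.1 ∧ {p.1.1, p.1.2.2} ∉ K)) := by
    simpa only [tripleIndex, Finset.mem_filter_univ] using p.2
  have hdual (p : tripleIndex K) : ∃ f : Module.Dual (ZMod 2) (LK K),
      f (tripleGen K p) = 1 ∧ ∀ q ≠ p, f (tripleGen K q) = 0 := by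
    obtain ⟨hsj, hsc, hjc, hK, hK'⟩ := hmem p
    have hne {q : tripleIndex K} (hq : q ≠ p) :
        ¬ (q.1.1 = p.1.1 ∧ q.1.2.1 = p.1.2.1 ∧ q.1.2.2 = p.1.2.2) := fun h =>
      hq (Subtype.ext (Prod.ext h.1 (Prod.ext h.2.1 h.2.2)))
    by_cases h : {p.1.1, p.1.2.1} ∈ K
    · have hpair := Finset.pair_comm p.1.1 p.1.2.1
      have hjs : p.1.2.1 < p.1.1 := by tauto
      have hcs : {p.1.2.2, p.1.1} ∉ K := by rw [Finset.pair_comm]; tauto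
      refine ⟨wordCoeff hK hcs, ?_, fun q hq => ?_⟩
      · rw [tripleGen, wordCoeff_lie, if_neg (by grind), if_neg (by grind), if_neg (by grind),
          if_pos (by grind)]
        decide
      · have hq' := hmem q
        have hne := hne hq
        rw [tripleGen, wordCoeff_lie, if_neg (by grind), if_neg (by grind), if_neg (by grind),
          if_neg (by grind)]
        decide
    · refine ⟨wordCoeff h hK, ?_, fun q hq => ?_⟩
      · rw [tripleGen, wordCoeff_lie, if_neg (by grind), if_pos (by grind), if_neg (by grind),
          if_neg (by grind)]
        decide
      · have hq' := hmem q
        have hne := hne hq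
        rw [tripleGen, wordCoeff_lie, if_neg (by grind), if_neg (by grind), if_neg (by grind),
          if_neg (by grind)]
        decide
  choose f hf using hdual
  exact LinearIndependent.of_pairwise_dual_eq_zero_one _ f
    (fun p q hpq => (hf p).2 q hpq.symm) fun p => (hf p).1

theorem nDim_two : nDim K 2 = (pairIndex K).card := by
  rw [nDim, NKdeg_two, finrank_span_eq_card linearIndependent_pairGen, Fintype.card_coe]

theorem nDim_three : nDim K 3 = (tripleIndex K).card := by
  rw [nDim, NKdeg_three, finrank_span_eq_card linearIndependent_tripleGen, Fintype.card_coe]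

end Independence

section Counting

variable {m : ℕ}

theorem card_pairIndex (K : Finset (Finset (Fin m))) :
    (pairIndex K).card =
      (((Finset.univ : Finset (Fin m)).powersetCard 2).filter (fun e => e ∉ K)).card := by
  refine Finset.card_bij (fun p _ => {p.1, p.2}) ?_ ?_ ?_
  · intro p hp
    simp only [pairIndex, Finset.mem_filter_univ] at hp
    simp [hp.2, Finset.card_pair hp.1.ne]
  · intro p hp q hq h
    simp only [pairIndex, Finset.mem_filter_univ] at hp hq
    have h1 : p.1 ∈ ({q.1, q.2} : Finset (Fin m)) := h ▸ by simp
    have h2 : p.2 ∈ ({q.1, q.2} : Finset (Fin m)) := h ▸ by simp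
    grind
  · intro e he
    simp only [Finset.mem_filter, Finset.mem_powersetCard_univ] at he
    obtain ⟨a, b, hab, rfl⟩ := Finset.card_eq_two.1 he.1
    rcases hab.lt_or_gt with h | h
    · exact ⟨(a, b), by simp [pairIndex, h, he.2], rfl⟩
    · exact ⟨(b, a), by simp [pairIndex, h, he.2, Finset.pair_comm b a], Finset.pair_comm _ _⟩

/-- The strictly increasing triples of vertices. -/
def increasingTriples (m : ℕ) : Finset (Fin m × Fin m × Fin m) :=
  Finset.univ.filter fun p => p.1 < p.2.1 ∧ p.2.1 < p.2.2

theorem exists_increasing_of_card_eq_three {J : Finset (Fin m)} (hJ : J.card = 3) :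
    ∃ a b c, a < b ∧ b < c ∧ {a, b, c} = J := by
  obtain ⟨x, y, z, hxy, hxz, hyz, rfl⟩ := Finset.card_eq_three.1 hJ
  rcases hxy.lt_or_gt with h1 | h1 <;> rcases hxz.lt_or_gt with h2 | h2 <;>
    rcases hyz.lt_or_gt with h3 | h3
  · exact ⟨x, y, z, h1, h3, rfl⟩
  · exact ⟨x, z, y, h2, h3, by grind⟩
  · exact absurd (h1.trans h3) h2.not_gt
  · exact ⟨z, x, y, h2, h1, by grind⟩
  · exact ⟨y, x, z, h1, h2, by grind⟩
  · exact absurd (h3.trans h1) h2.not_gt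
  · exact ⟨y, z, x, h3, h2, by grind⟩
  · exact ⟨z, y, x, h3, h1, by grind⟩

theorem card_filter_powersetCard_three (P : Finset (Fin m) → Prop) [DecidablePred P] :
    (((Finset.univ : Finset (Fin m)).powersetCard 3).filter P).card =
      ((increasingTriples m).filter fun p => P {p.1, p.2.1, p.2.2}).card := by
  symm
  refine Finset.card_bij (fun p _ => {p.1, p.2.1, p.2.2}) ?_ ?_ ?_
  · intro p hp
    simp only [increasingTriples, Finset.mem_filter, Finset.mem_univ, true_and] at hp
    simp only [Finset.mem_filter, Finset.mem_powersetCard_univ]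
    exact ⟨Finset.card_eq_three.2 ⟨_, _, _, hp.1.1.ne, (hp.1.1.trans hp.1.2).ne, hp.1.2.ne, rfl⟩,
      hp.2⟩
  · intro p hp q hq h
    simp only [increasingTriples, Finset.mem_filter, Finset.mem_univ, true_and] at hp hq
    have h1 : p.1 ∈ ({q.1, q.2.1, q.2.2} : Finset (Fin m)) := h ▸ by simp
    have h2 : p.2.1 ∈ ({q.1, q.2.1, q.2.2} : Finset (Fin m)) := h ▸ by simp
    have h3 : p.2.2 ∈ ({q.1, q.2.1, q.2.2} : Finset (Fin m)) := h ▸ by simp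
    grind
  · intro J hJ
    simp only [Finset.mem_filter, Finset.mem_powersetCard_univ] at hJ
    obtain ⟨a, b, c, hab, hbc, rfl⟩ := exists_increasing_of_card_eq_three hJ.1
    exact ⟨(a, b, c), by simp [increasingTriples, hab, hbc, hJ.2], rfl⟩

theorem card_edges_triple (K : Finset (Finset (Fin m))) {a b c : Fin m} (hab : a < b)
    (hbc : b < c) :
    (K.filter fun I => I.card = 2 ∧ I ⊆ {a, b, c}).card =
      (if {a, b} ∈ K then 1 else 0) + (if {a, c} ∈ K then 1 else 0) +
        (if {b, c} ∈ K then 1 else 0) := by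
  have hac := hab.trans hbc
  have hset : (K.filter fun I => I.card = 2 ∧ I ⊆ {a, b, c}) =
      ({{a, b}, {a, c}, {b, c}} : Finset (Finset (Fin m))).filter (· ∈ K) := by
    ext I
    simp only [Finset.mem_filter, Finset.mem_insert, Finset.mem_singleton]
    refine ⟨fun ⟨hI, hcard, hsub⟩ => ⟨?_, hI⟩, fun ⟨hI, hK⟩ => ⟨hK, ?_⟩⟩
    · obtain ⟨x, y, hxy, rfl⟩ := Finset.card_eq_two.1 hcard
      have hx : x = a ∨ x = b ∨ x = c := by simpa using hsub (Finset.mem_insert_self x {y})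
      have hy : y = a ∨ y = b ∨ y = c := by simpa using hsub (show y ∈ {x, y} by simp)
      rcases hx with rfl | rfl | rfl <;> rcases hy with rfl | rfl | rfl <;>
        simp [Finset.pair_comm] at hxy ⊢
    · rcases hI with rfl | rfl | rfl
      · exact ⟨Finset.card_pair hab.ne, by grind⟩
      · exact ⟨Finset.card_pair hac.ne, by grind⟩
      · exact ⟨Finset.card_pair hbc.ne, by grind⟩
  have h1 : ({a, b} : Finset (Fin m)) ∉ ({{a, c}, {b, c}} : Finset (Finset (Fin m))) := by
    intro h
    have hb : c ∈ ({a, b} : Finset (Fin m)) := by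
      simp only [Finset.mem_insert, Finset.mem_singleton] at h
      rcases h with h | h <;> rw [h] <;> simp
    grind
  have h2 : ({a, c} : Finset (Fin m)) ∉ ({{b, c}} : Finset (Finset (Fin m))) := by
    intro h
    have ha : a ∈ ({b, c} : Finset (Fin m)) := by
      rw [← Finset.mem_singleton.1 h]; simp
    grind
  rw [hset, Finset.card_filter, Finset.sum_insert h1, Finset.sum_insert h2,
    Finset.sum_singleton, add_assoc]

theorem card_tripleIndex (K : Finset (Finset (Fin m))) :
    (tripleIndex K).card =
      ((increasingTriples m).filter fun p => {p.2.1, p.2.2} ∉ K ∧ {p.1, p.2.1} ∉ K).card +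
      ((increasingTriples m).filter fun p => {p.1, p.2.2} ∉ K ∧
        ({p.1, p.2.1} ∉ K ∨ {p.2.1, p.2.2} ∉ K)).card := by
  rw [← Finset.card_filter_add_card_filter_not (s := tripleIndex K) (fun p => p.1 < p.2.1)]
  congr 1
  · congr 1
    ext p
    simp only [tripleIndex, increasingTriples, Finset.mem_filter, Finset.mem_univ, true_and]
    grind
  · refine Finset.card_nbij' (fun p => (p.2.1, p.1, p.2.2)) (fun p => (p.2.1, p.1, p.2.2))
      ?_ ?_ (fun _ _ => rfl) (fun _ _ => rfl) <;>
    · intro p hp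
      have := Finset.pair_comm p.1 p.2.1
      simp only [tripleIndex, increasingTriples, Finset.coe_filter, Finset.mem_filter,
        Finset.mem_univ, true_and, Set.mem_ofPred_eq] at hp ⊢
      grind

theorem card_tripleIndex_eq (K : Finset (Finset (Fin m))) :
    (tripleIndex K).card =
      2 * (((Finset.univ : Finset (Fin m)).powersetCard 3).filter
            (fun J => (K.filter (fun I => I.card = 2 ∧ I ⊆ J)).card = 0)).card +
        (((Finset.univ : Finset (Fin m)).powersetCard 3).filter
            (fun J => (K.filter (fun I => I.card = 2 ∧ I ⊆ J)).card = 1)).card := by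
  rw [card_tripleIndex, card_filter_powersetCard_three, card_filter_powersetCard_three]
  rw [Finset.card_filter, Finset.card_filter, Finset.card_filter, Finset.card_filter]
  rw [Finset.mul_sum, ← Finset.sum_add_distrib, ← Finset.sum_add_distrib]
  refine Finset.sum_congr rfl fun p hp => ?_
  simp only [increasingTriples, Finset.mem_filter_univ] at hp
  rw [card_edges_triple K hp.1 hp.2]
  by_cases h1 : {p.1, p.2.1} ∈ K <;> by_cases h2 : {p.1, p.2.2} ∈ K <;>
    by_cases h3 : {p.2.1, p.2.2} ∈ K <;> simp [h1, h2, h3]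

end Counting

/-- Let `K` be a flag simplicial complex on `[m]`.  Then
`n₂(K)` is the number of `2`-element subsets of `[m]` that are not simplices
of `K`, and `n₃(K) = 2·t₀ + t₁`, where `t₀` (resp. `t₁`) is the number of
`3`-element subsets of `[m]` containing no (resp. exactly one) `2`-element
simplex of `K`. -/
theorem NK_low_degrees {m : ℕ} (K : Finset (Finset (Fin m)))
    (hK : IsSimplicialComplex K) (hflag : IsFlag K) :
    nDim K 2 =
      (((Finset.univ : Finset (Fin m)).powersetCard 2).filter (fun e => e ∉ K)).card ∧
    nDim K 3 =
      2 * (((Finset.univ : Finset (Fin m)).powersetCard 3).filter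
            (fun J => (K.filter (fun I => I.card = 2 ∧ I ⊆ J)).card = 0)).card +
        (((Finset.univ : Finset (Fin m)).powersetCard 3).filter
            (fun J => (K.filter (fun I => I.card = 2 ∧ I ⊆ J)).card = 1)).card := by
  exact ⟨nDim_two.trans (card_pairIndex K), nDim_three.trans (card_tripleIndex_eq K)⟩
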